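/- For every valid online translation strategy σ, every integer m ≥ 1, and every real p > 0, there exists a stream L of m² + 1 pieces such that OPT(L) ≤ 2p² and ALG_σ(L) ≥ m·p², where the cost is the area of the bounding box. -/

import Mathlib

open Set

/-- A piece is a pair (w,h) of (intended positive) real numbers. -/
abbrev Piece := ℝ × ℝ

/-- Both edge lengths of the piece are positive. -/
def PiecePos (p : Piece) : Prop := 0 < p.1 ∧ 0 < p.2

/-- The axis-parallel closed rectangle obtained by placing piece `p` by
translation at the point `q`. -/
def placedRect (p : Piece) (q : ℝ × ℝ) : Set (ℝ × ℝ) :=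
  Set.Icc q.1 (q.1 + p.1) ×ˢ Set.Icc q.2 (q.2 + p.2)

/-- Width of the axis-parallel bounding box of a set in the plane. -/
noncomputable def boxWidth (S : Set (ℝ × ℝ)) : ℝ :=
  sSup (Prod.fst '' S) - sInf (Prod.fst '' S)

/-- Height of the axis-parallel bounding box of a set in the plane. -/
noncomputable def boxHeight (S : Set (ℝ × ℝ)) : ℝ :=
  sSup (Prod.snd '' S) - sInf (Prod.snd '' S)

/-! ### Translations only -/

/-- `pos` is a packing (by translations) of the list `L` of pieces:
the placed rectangles have pairwise disjoint interiors. -/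
def IsPacking (L : List Piece) (pos : Fin L.length → ℝ × ℝ) : Prop :=
  ∀ i j : Fin L.length, i ≠ j →
    Disjoint (interior (placedRect (L.get i) (pos i)))
             (interior (placedRect (L.get j) (pos j)))

/-- The union of the placed rectangles. -/
def packedSet (L : List Piece) (pos : Fin L.length → ℝ × ℝ) : Set (ℝ × ℝ) :=
  ⋃ i : Fin L.length, placedRect (L.get i) (pos i)

/-- Perimeter of the bounding box of a packing. -/
noncomputable def periCost (L : List Piece) (pos : Fin L.length → ℝ × ℝ) : ℝ :=
  2 * (boxWidth (packedSet L pos) + boxHeight (packedSet L pos))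

/-- Area of the bounding box of a packing. -/
noncomputable def areaCost (L : List Piece) (pos : Fin L.length → ℝ × ℝ) : ℝ :=
  boxWidth (packedSet L pos) * boxHeight (packedSet L pos)

/-- Optimal offline bounding-box perimeter for the pieces of `L`. -/
noncomputable def optPeri (L : List Piece) : ℝ :=
  sInf { c | ∃ pos : Fin L.length → ℝ × ℝ, IsPacking L pos ∧ periCost L pos = c }

/-- Optimal offline bounding-box area for the pieces of `L`. -/
noncomputable def optArea (L : List Piece) : ℝ :=
  sInf { c | ∃ pos : Fin L.length → ℝ × ℝ, IsPacking L pos ∧ areaCost L pos = c }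

/-- The positions chosen by the online strategy `σ` on the stream `L`:
the `i`-th piece is placed at the point chosen by `σ` as a function of the
first `i+1` pieces. -/
def onlinePos (σ : List Piece → ℝ × ℝ) (L : List Piece) :
    Fin L.length → ℝ × ℝ :=
  fun i => σ (L.take ((i : ℕ) + 1))

/-- `σ` is a valid online translation strategy: on every stream of pieces it
produces a packing. -/
def StrategyValid (σ : List Piece → ℝ × ℝ) : Prop :=
  ∀ L : List Piece, (∀ p ∈ L, PiecePos p) → IsPacking L (onlinePos σ L)

/-- Perimeter of the bounding box of the packing produced by `σ` on `L`. -/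
noncomputable def algPeri (σ : List Piece → ℝ × ℝ) (L : List Piece) : ℝ :=
  periCost L (onlinePos σ L)

/-- Area of the bounding box of the packing produced by `σ` on `L`. -/
noncomputable def algArea (σ : List Piece → ℝ × ℝ) (L : List Piece) : ℝ :=
  areaCost L (onlinePos σ L)

/-! ### Rotations by 90° allowed -/

/-- The piece `p` in the orientation given by `r`: rotated by 90° if `r` is
`true`. -/
def orient (p : Piece) (r : Bool) : Piece := if r then (p.2, p.1) else p

/-- `pos, rot` is a packing with rotations of the list `L` of pieces. -/
def IsRotPacking (L : List Piece) (pos : Fin L.length → ℝ × ℝ)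
    (rot : Fin L.length → Bool) : Prop :=
  ∀ i j : Fin L.length, i ≠ j →
    Disjoint (interior (placedRect (orient (L.get i) (rot i)) (pos i)))
             (interior (placedRect (orient (L.get j) (rot j)) (pos j)))

/-- The union of the placed (possibly rotated) rectangles. -/
def packedRotSet (L : List Piece) (pos : Fin L.length → ℝ × ℝ)
    (rot : Fin L.length → Bool) : Set (ℝ × ℝ) :=
  ⋃ i : Fin L.length, placedRect (orient (L.get i) (rot i)) (pos i)

/-- Perimeter of the bounding box of a packing with rotations. -/
noncomputable def periRotCost (L : List Piece) (pos : Fin L.length → ℝ × ℝ)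
    (rot : Fin L.length → Bool) : ℝ :=
  2 * (boxWidth (packedRotSet L pos rot) + boxHeight (packedRotSet L pos rot))

/-- Area of the bounding box of a packing with rotations. -/
noncomputable def areaRotCost (L : List Piece) (pos : Fin L.length → ℝ × ℝ)
    (rot : Fin L.length → Bool) : ℝ :=
  boxWidth (packedRotSet L pos rot) * boxHeight (packedRotSet L pos rot)

/-- Optimal offline bounding-box perimeter with rotations allowed. -/
noncomputable def optRotPeri (L : List Piece) : ℝ :=
  sInf { c | ∃ (pos : Fin L.length → ℝ × ℝ) (rot : Fin L.length → Bool),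
    IsRotPacking L pos rot ∧ periRotCost L pos rot = c }

/-- Optimal offline bounding-box area with rotations allowed. -/
noncomputable def optRotArea (L : List Piece) : ℝ :=
  sInf { c | ∃ (pos : Fin L.length → ℝ × ℝ) (rot : Fin L.length → Bool),
    IsRotPacking L pos rot ∧ areaRotCost L pos rot = c }

/-- The positions chosen by the online rotation strategy `σ` on the stream `L`. -/
def onlineRotPos (σ : List Piece → (ℝ × ℝ) × Bool) (L : List Piece) :
    Fin L.length → ℝ × ℝ :=
  fun i => (σ (L.take ((i : ℕ) + 1))).1

/-- The orientations chosen by the online rotation strategy `σ` on the stream `L`. -/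
def onlineRot (σ : List Piece → (ℝ × ℝ) × Bool) (L : List Piece) :
    Fin L.length → Bool :=
  fun i => (σ (L.take ((i : ℕ) + 1))).2

/-- `σ` is a valid online rotation strategy: on every stream of pieces it
produces a packing with rotations. -/
def RotStrategyValid (σ : List Piece → (ℝ × ℝ) × Bool) : Prop :=
  ∀ L : List Piece, (∀ p ∈ L, PiecePos p) →
    IsRotPacking L (onlineRotPos σ L) (onlineRot σ L)

/-- Perimeter of the bounding box of the packing produced by `σ` on `L`. -/
noncomputable def algRotPeri (σ : List Piece → (ℝ × ℝ) × Bool) (L : List Piece) : ℝ :=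
  periRotCost L (onlineRotPos σ L) (onlineRot σ L)

/-- Area of the bounding box of the packing produced by `σ` on `L`. -/
noncomputable def algRotArea (σ : List Piece → (ℝ × ℝ) × Bool) (L : List Piece) : ℝ :=
  areaRotCost L (onlineRotPos σ L) (onlineRot σ L)

/-! ### Square pieces, bounding-square cost -/

/-- The axis-parallel closed square of side `s` placed at the point `q`. -/
def placedSq (s : ℝ) (q : ℝ × ℝ) : Set (ℝ × ℝ) :=
  Set.Icc q.1 (q.1 + s) ×ˢ Set.Icc q.2 (q.2 + s)

/-- `pos` is a packing of the list `L` of square pieces. -/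
def IsSqPacking (L : List ℝ) (pos : Fin L.length → ℝ × ℝ) : Prop :=
  ∀ i j : Fin L.length, i ≠ j →
    Disjoint (interior (placedSq (L.get i) (pos i)))
             (interior (placedSq (L.get j) (pos j)))

/-- The union of the placed squares. -/
def packedSqSet (L : List ℝ) (pos : Fin L.length → ℝ × ℝ) : Set (ℝ × ℝ) :=
  ⋃ i : Fin L.length, placedSq (L.get i) (pos i)

/-- Area of the smallest axis-parallel square containing all placed squares. -/
noncomputable def sqCost (L : List ℝ) (pos : Fin L.length → ℝ × ℝ) : ℝ :=
  (max (boxWidth (packedSqSet L pos)) (boxHeight (packedSqSet L pos))) ^ 2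

/-- Optimal offline bounding-square area for the square pieces of `L`. -/
noncomputable def optSq (L : List ℝ) : ℝ :=
  sInf { c | ∃ pos : Fin L.length → ℝ × ℝ, IsSqPacking L pos ∧ sqCost L pos = c }

/-- The positions chosen by the online strategy `σ` on the stream `L` of
square pieces. -/
def onlineSqPos (σ : List ℝ → ℝ × ℝ) (L : List ℝ) : Fin L.length → ℝ × ℝ :=
  fun i => σ (L.take ((i : ℕ) + 1))

/-- `σ` is a valid online translation strategy for square pieces. -/
def SqStrategyValid (σ : List ℝ → ℝ × ℝ) : Prop :=
  ∀ L : List ℝ, (∀ s ∈ L, 0 < s) → IsSqPacking L (onlineSqPos σ L)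

/-- Bounding-square area of the packing produced by `σ` on `L`. -/
noncomputable def algSq (σ : List ℝ → ℝ × ℝ) (L : List ℝ) : ℝ :=
  sqCost L (onlineSqPos σ L)

open MeasureTheory in
theorem volume_interior_placedRect (a q : ℝ × ℝ) :
    volume (interior (placedRect a q)) = ENNReal.ofReal a.1 * ENNReal.ofReal a.2 := by
  rw [placedRect, interior_prod_eq, interior_Icc, interior_Icc, Measure.volume_eq_prod,
    Measure.prod_prod, Real.volume_Ioo, Real.volume_Ioo, add_sub_cancel_left, add_sub_cancel_left]

theorem disjoint_interior_placedRect {a b q r : ℝ × ℝ}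
    (h : q.1 + a.1 ≤ r.1 ∨ q.2 + a.2 ≤ r.2) :
    Disjoint (interior (placedRect a q)) (interior (placedRect b r)) := by
  simp only [placedRect, interior_prod_eq, interior_Icc]
  rw [Set.disjoint_left]
  rintro x ⟨h1, h2⟩ ⟨h3, h4⟩
  simp only [Set.mem_Ioo] at h1 h2 h3 h4
  rcases h with h | h <;> linarith [h1.2, h2.2, h3.1, h4.1]

theorem isPacking_of_lt {L : List Piece} {pos : Fin L.length → ℝ × ℝ}
    (h : ∀ i j : Fin L.length, i < j →
      (pos i).1 + (L.get i).1 ≤ (pos j).1 ∨ (pos i).2 + (L.get i).2 ≤ (pos j).2) :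
    IsPacking L pos := by
  intro i j hij
  rcases lt_or_gt_of_ne hij with hlt | hlt
  · exact disjoint_interior_placedRect (h i j hlt)
  · exact (disjoint_interior_placedRect (h j i hlt)).symm

theorem isCompact_packedSet (L : List Piece) (pos : Fin L.length → ℝ × ℝ) :
    IsCompact (packedSet L pos) :=
  isCompact_iUnion fun _ => isCompact_Icc.prod isCompact_Icc

section Box

variable {S T : Set (ℝ × ℝ)} {x y : ℝ × ℝ}

theorem boxWidth_nonneg (hS : IsCompact S) : 0 ≤ boxWidth S :=
  sub_nonneg.2 <| Real.sInf_le_sSup _ (hS.image continuous_fst).bddBelow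
    (hS.image continuous_fst).bddAbove

theorem boxHeight_nonneg (hS : IsCompact S) : 0 ≤ boxHeight S :=
  sub_nonneg.2 <| Real.sInf_le_sSup _ (hS.image continuous_snd).bddBelow
    (hS.image continuous_snd).bddAbove

theorem boxWidth_mono (hT : IsCompact T) (h : S ⊆ T) (hS : S.Nonempty) :
    boxWidth S ≤ boxWidth T :=
  sub_le_sub
    (csSup_le_csSup (hT.image continuous_fst).bddAbove (hS.image _) (Set.image_mono h))
    (csInf_le_csInf (hT.image continuous_fst).bddBelow (hS.image _) (Set.image_mono h))

theorem boxHeight_mono (hT : IsCompact T) (h : S ⊆ T) (hS : S.Nonempty) :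
    boxHeight S ≤ boxHeight T :=
  sub_le_sub
    (csSup_le_csSup (hT.image continuous_snd).bddAbove (hS.image _) (Set.image_mono h))
    (csInf_le_csInf (hT.image continuous_snd).bddBelow (hS.image _) (Set.image_mono h))

theorem sub_le_boxWidth (hS : IsCompact S) (hx : x ∈ S) (hy : y ∈ S) :
    y.1 - x.1 ≤ boxWidth S :=
  sub_le_sub
    (le_csSup (hS.image continuous_fst).bddAbove (Set.mem_image_of_mem _ hy))
    (csInf_le (hS.image continuous_fst).bddBelow (Set.mem_image_of_mem _ hx))

theorem sub_le_boxHeight (hS : IsCompact S) (hx : x ∈ S) (hy : y ∈ S) :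
    y.2 - x.2 ≤ boxHeight S :=
  sub_le_sub
    (le_csSup (hS.image continuous_snd).bddAbove (Set.mem_image_of_mem _ hy))
    (csInf_le (hS.image continuous_snd).bddBelow (Set.mem_image_of_mem _ hx))

theorem boxWidth_le {a b : ℝ} (hS : S.Nonempty) (h : ∀ x ∈ S, a ≤ x.1 ∧ x.1 ≤ b) :
    boxWidth S ≤ b - a :=
  sub_le_sub
    (csSup_le (hS.image _) (Set.forall_mem_image.2 fun x hx => (h x hx).2))
    (le_csInf (hS.image _) (Set.forall_mem_image.2 fun x hx => (h x hx).1))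

theorem boxHeight_le {a b : ℝ} (hS : S.Nonempty) (h : ∀ x ∈ S, a ≤ x.2 ∧ x.2 ≤ b) :
    boxHeight S ≤ b - a :=
  sub_le_sub
    (csSup_le (hS.image _) (Set.forall_mem_image.2 fun x hx => (h x hx).2))
    (le_csInf (hS.image _) (Set.forall_mem_image.2 fun x hx => (h x hx).1))

theorem subset_Icc_prod_Icc (hS : IsCompact S) :
    S ⊆ Set.Icc (sInf (Prod.fst '' S)) (sSup (Prod.fst '' S)) ×ˢ
      Set.Icc (sInf (Prod.snd '' S)) (sSup (Prod.snd '' S)) := fun _ hx =>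
  ⟨⟨csInf_le (hS.image continuous_fst).bddBelow (Set.mem_image_of_mem _ hx),
    le_csSup (hS.image continuous_fst).bddAbove (Set.mem_image_of_mem _ hx)⟩,
   ⟨csInf_le (hS.image continuous_snd).bddBelow (Set.mem_image_of_mem _ hx),
    le_csSup (hS.image continuous_snd).bddAbove (Set.mem_image_of_mem _ hx)⟩⟩

end Box

section Cost

variable {L : List Piece} {pos : Fin L.length → ℝ × ℝ}

theorem areaCost_nonneg : 0 ≤ areaCost L pos :=
  mul_nonneg (boxWidth_nonneg (isCompact_packedSet L pos))
    (boxHeight_nonneg (isCompact_packedSet L pos))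

theorem optArea_le_areaCost (h : IsPacking L pos) : optArea L ≤ areaCost L pos :=
  csInf_le ⟨0, by rintro _ ⟨_, _, rfl⟩; exact areaCost_nonneg⟩ ⟨pos, h, rfl⟩

theorem placedRect_subset_packedSet (i : Fin L.length) :
    placedRect (L.get i) (pos i) ⊆ packedSet L pos :=
  Set.subset_iUnion (fun i => placedRect (L.get i) (pos i)) i

theorem left_mem_placedRect {a : Piece} (ha : PiecePos a) (q : ℝ × ℝ) : q ∈ placedRect a q :=
  ⟨⟨le_rfl, by linarith [ha.1]⟩, ⟨le_rfl, by linarith [ha.2]⟩⟩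

theorem right_mem_placedRect {a : Piece} (ha : PiecePos a) (q : ℝ × ℝ) :
    q + a ∈ placedRect a q :=
  ⟨⟨by simpa using ha.1.le, le_rfl⟩, ⟨by simpa using ha.2.le, le_rfl⟩⟩

theorem packedSet_nonempty (hL : ∀ q ∈ L, PiecePos q) (i : Fin L.length) :
    (packedSet L pos).Nonempty :=
  ⟨pos i, placedRect_subset_packedSet i (left_mem_placedRect (hL _ (L.get_mem i)) _)⟩

theorem width_le_boxWidth (hL : ∀ q ∈ L, PiecePos q) (i : Fin L.length) :
    (L.get i).1 ≤ boxWidth (packedSet L pos) := by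
  have h := hL _ (L.get_mem i)
  simpa using sub_le_boxWidth (isCompact_packedSet L pos)
    (placedRect_subset_packedSet i (left_mem_placedRect h _))
    (placedRect_subset_packedSet i (right_mem_placedRect h _))

theorem height_le_boxHeight (hL : ∀ q ∈ L, PiecePos q) (i : Fin L.length) :
    (L.get i).2 ≤ boxHeight (packedSet L pos) := by
  have h := hL _ (L.get_mem i)
  simpa using sub_le_boxHeight (isCompact_packedSet L pos)
    (placedRect_subset_packedSet i (left_mem_placedRect h _))
    (placedRect_subset_packedSet i (right_mem_placedRect h _))

open MeasureTheory in
theorem sum_area_le_areaCost (hL : ∀ q ∈ L, PiecePos q) (h : IsPacking L pos) :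
    ∑ i : Fin L.length, (L.get i).1 * (L.get i).2 ≤ areaCost L pos := by
  have hc := isCompact_packedSet L pos
  have hpos : ∀ i : Fin L.length, 0 ≤ (L.get i).1 * (L.get i).2 := fun i =>
    (mul_pos (hL _ (L.get_mem i)).1 (hL _ (L.get_mem i)).2).le
  have hvol : volume (⋃ i, interior (placedRect (L.get i) (pos i)))
      = ENNReal.ofReal (∑ i : Fin L.length, (L.get i).1 * (L.get i).2) := by
    rw [measure_iUnion (fun i j hij => h i j hij) (fun i => isOpen_interior.measurableSet),
      tsum_fintype, ENNReal.ofReal_sum_of_nonneg fun i _ => hpos i]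
    refine Finset.sum_congr rfl fun i _ => ?_
    rw [volume_interior_placedRect, ENNReal.ofReal_mul (hL _ (L.get_mem i)).1.le]
  have hsub : (⋃ i, interior (placedRect (L.get i) (pos i))) ⊆ packedSet L pos :=
    Set.iUnion_mono fun i => interior_subset
  have hle := measure_mono (μ := volume) (hsub.trans (subset_Icc_prod_Icc hc))
  rw [hvol, Measure.volume_eq_prod, Measure.prod_prod, Real.volume_Icc, Real.volume_Icc,
    ← ENNReal.ofReal_mul (by exact boxWidth_nonneg hc)] at hle
  exact (ENNReal.ofReal_le_ofReal_iff areaCost_nonneg).1 hle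

theorem areaCost_le {a b : ℝ} (hL : ∀ q ∈ L, PiecePos q) (i₀ : Fin L.length)
    (h : ∀ i, 0 ≤ (pos i).1 ∧ (pos i).1 + (L.get i).1 ≤ a ∧
      0 ≤ (pos i).2 ∧ (pos i).2 + (L.get i).2 ≤ b) :
    areaCost L pos ≤ a * b := by
  have hne : (packedSet L pos).Nonempty := packedSet_nonempty hL i₀
  have hmem : ∀ x ∈ packedSet L pos, (0 ≤ x.1 ∧ x.1 ≤ a) ∧ (0 ≤ x.2 ∧ x.2 ≤ b) := by
    intro x hx
    obtain ⟨i, ⟨h1, h2⟩, h3, h4⟩ := Set.mem_iUnion.1 hx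
    obtain ⟨k1, k2, k3, k4⟩ := h i
    exact ⟨⟨k1.trans h1, h2.trans k2⟩, ⟨k3.trans h3, h4.trans k4⟩⟩
  have hc := isCompact_packedSet L pos
  have hw := boxWidth_le hne fun x hx => (hmem x hx).1
  have hh := boxHeight_le hne fun x hx => (hmem x hx).2
  rw [sub_zero] at hw hh
  exact mul_le_mul hw hh (boxHeight_nonneg hc) ((boxWidth_nonneg hc).trans hw)

end Cost

theorem packedSet_onlinePos_subset_append (σ : List Piece → ℝ × ℝ) (L M : List Piece) :
    packedSet L (onlinePos σ L) ⊆ packedSet (L ++ M) (onlinePos σ (L ++ M)) := by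
  refine Set.iUnion_subset fun i => ?_
  have hi : (i : ℕ) < (L ++ M).length := by
    have := i.2
    rw [List.length_append]; omega
  have h := placedRect_subset_packedSet (pos := onlinePos σ (L ++ M)) ⟨i, hi⟩
  have hget : (L ++ M).get ⟨i, hi⟩ = L.get i := by
    simp [List.getElem_append_left]
  have hpos : onlinePos σ (L ++ M) ⟨i, hi⟩ = onlinePos σ L i := by
    simp only [onlinePos]
    rw [List.take_append_of_le_length i.2]
  rwa [hget, hpos] at h

theorem get_replicate_append_singleton {n : ℕ} {a b : Piece}
    (i : Fin (List.replicate n a ++ [b]).length) :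
    (List.replicate n a ++ [b]).get i = if (i : ℕ) < n then a else b := by
  simp [List.getElem_append]

theorem piecePos_of_mem_replicate_append {n : ℕ} {a b : Piece} (ha : PiecePos a)
    (hb : PiecePos b) : ∀ q ∈ List.replicate n a ++ [b], PiecePos q := by
  intro q hq
  rcases List.mem_append.1 hq with h | h
  · exact List.eq_of_mem_replicate h ▸ ha
  · exact List.mem_singleton.1 h ▸ hb

/-- Stacking `n` equal pieces and then one piece of the same width. -/
theorem optArea_replicate_stack (n : ℕ) {w h k : ℝ} (hw : 0 < w) (hh : 0 < h) (hk : 0 < k) :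
    optArea (List.replicate n (w, h) ++ [(w, k)]) ≤ w * (n * h + k) := by
  set L : List Piece := List.replicate n (w, h) ++ [(w, k)] with hLdef
  have hlen : L.length = n + 1 := by simp [hLdef]
  have hL : ∀ q ∈ L, PiecePos q := piecePos_of_mem_replicate_append ⟨hw, hh⟩ ⟨hw, hk⟩
  have hget : ∀ i : Fin L.length, L.get i = if (i : ℕ) < n then (w, h) else (w, k) :=
    get_replicate_append_singleton
  let pos : Fin L.length → ℝ × ℝ := fun i => (0, (i : ℕ) * h)
  have hstep : ∀ i j : ℕ, i < j → (i : ℝ) * h + h ≤ j * h := by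
    intro i j hij
    have : (i : ℝ) + 1 ≤ j := by exact_mod_cast hij
    nlinarith
  have hpack : IsPacking L pos := by
    refine isPacking_of_lt fun i j hij => Or.inr ?_
    have hi : (i : ℕ) < n := by have := j.2; omega
    rw [hget, if_pos hi]
    exact hstep i j hij
  refine (optArea_le_areaCost hpack).trans (areaCost_le hL ⟨0, by omega⟩ fun i => ?_)
  rw [hget]
  refine ⟨le_rfl, ?_, by positivity, ?_⟩
  · split_ifs <;> simp [pos]
  · split_ifs with hi
    · linarith [hstep i n hi]
    · have : (i : ℕ) = n := by have := i.2; omega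
      simp [pos, this]

/-- Placing `n` equal pieces in a row, below one piece spanning the whole row. -/
theorem optArea_replicate_row (n : ℕ) {w h k : ℝ} (hn : 0 < n) (hw : 0 < w) (hh : 0 < h)
    (hk : 0 < k) :
    optArea (List.replicate n (w, h) ++ [(n * w, k)]) ≤ n * w * (h + k) := by
  set L : List Piece := List.replicate n (w, h) ++ [(n * w, k)] with hLdef
  have hlen : L.length = n + 1 := by simp [hLdef]
  have hL : ∀ q ∈ L, PiecePos q :=
    piecePos_of_mem_replicate_append ⟨hw, hh⟩ ⟨by positivity, hk⟩
  have hget : ∀ i : Fin L.length, L.get i = if (i : ℕ) < n then (w, h) else (n * w, k) :=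
    get_replicate_append_singleton
  let pos : Fin L.length → ℝ × ℝ := fun i => if (i : ℕ) < n then ((i : ℕ) * w, 0) else (0, h)
  have hstep : ∀ i j : ℕ, i < j → (i : ℝ) * w + w ≤ j * w := by
    intro i j hij
    have : (i : ℝ) + 1 ≤ j := by exact_mod_cast hij
    nlinarith
  have hpack : IsPacking L pos := by
    refine isPacking_of_lt fun i j hij => ?_
    have hi : (i : ℕ) < n := by have := j.2; omega
    by_cases hj : (j : ℕ) < n
    · left
      simpa only [hget, pos, if_pos hi, if_pos hj] using hstep i j hij
    · right
      simp only [hget, pos, if_pos hi, if_neg hj, zero_add, le_refl]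
  refine (optArea_le_areaCost hpack).trans (areaCost_le hL ⟨0, by omega⟩ fun i => ?_)
  rw [hget]
  by_cases hi : (i : ℕ) < n
  · simp only [pos, if_pos hi]
    exact ⟨by positivity, hstep i n hi, le_rfl, by linarith⟩
  · simp only [pos, if_neg hi]
    exact ⟨le_rfl, by linarith, hh.le, le_rfl⟩

/-- For every valid online translation strategy `σ`, every
integer `m ≥ 1` and every real `p > 0`, there exists a stream `L` of
`m² + 1` pieces such that `OPT(L) ≤ 2p²` and `ALG_σ(L) ≥ m * p²` (area of
the bounding box). -/
theorem area_translation_adversary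
    (σ : List Piece → ℝ × ℝ) (hσ : StrategyValid σ)
    (m : ℕ) (hm : 1 ≤ m) (p : ℝ) (hp : 0 < p) :
    ∃ L : List Piece, L.length = m ^ 2 + 1 ∧ (∀ q ∈ L, PiecePos q) ∧
      optArea L ≤ 2 * p ^ 2 ∧ (m : ℝ) * p ^ 2 ≤ algArea σ L := by
  have hm0 : (0 : ℝ) < m := by exact_mod_cast hm
  have hn : 0 < m ^ 2 := by positivity
  have hh : 0 < p / (m : ℝ) ^ 2 := by positivity
  set a : Piece := (p, p / (m : ℝ) ^ 2) with ha
  have hapos : PiecePos a := ⟨hp, hh⟩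
  set M : List Piece := List.replicate (m ^ 2) a with hMdef
  have hM : ∀ q ∈ M, PiecePos q := fun q hq => List.eq_of_mem_replicate hq ▸ hapos
  have hne : (packedSet M (onlinePos σ M)).Nonempty :=
    packedSet_nonempty hM ⟨0, by simpa [hMdef] using hn⟩
  have hMarea : p ^ 2 ≤ areaCost M (onlinePos σ M) := by
    refine le_trans (le_of_eq ?_) (sum_area_le_areaCost hM (hσ M hM))
    have : ∀ i : Fin M.length, (M.get i).1 * (M.get i).2 = p * (p / (m : ℝ) ^ 2) := by
      intro i
      simp [hMdef, ha]
    rw [Finset.sum_congr rfl fun i _ => this i]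
    simp [hMdef]
    field_simp
  have hlast : ∀ b : Piece, PiecePos b →
      b.1 ≤ boxWidth (packedSet (M ++ [b]) (onlinePos σ (M ++ [b]))) ∧
      b.2 ≤ boxHeight (packedSet (M ++ [b]) (onlinePos σ (M ++ [b]))) := by
    intro b hb
    have hL := piecePos_of_mem_replicate_append (n := m ^ 2) hapos hb
    have hget : (M ++ [b]).get ⟨M.length, by simp⟩ = b := by simp
    constructor
    · simpa only [hget] using width_le_boxWidth (pos := onlinePos σ (M ++ [b])) hL
        ⟨M.length, by simp⟩
    · simpa only [hget] using height_le_boxHeight (pos := onlinePos σ (M ++ [b])) hL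
        ⟨M.length, by simp⟩
  by_cases hW : m * p ≤ boxWidth (packedSet M (onlinePos σ M))
  · have hb : PiecePos (p, p) := ⟨hp, hp⟩
    refine ⟨M ++ [(p, p)], by simp [hMdef], piecePos_of_mem_replicate_append hapos hb, ?_, ?_⟩
    · refine (optArea_replicate_stack (m ^ 2) hp hh hp).trans (le_of_eq ?_)
      push_cast
      field_simp
      ring
    · have hw := hW.trans (boxWidth_mono (isCompact_packedSet _ _)
        (packedSet_onlinePos_subset_append σ M [(p, p)]) hne)
      calc (m : ℝ) * p ^ 2 = m * p * p := by ring
        _ ≤ _ := mul_le_mul hw (hlast _ hb).2 hp.le (le_trans (by positivity) hw)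
  · have hH : p / m ≤ boxHeight (packedSet M (onlinePos σ M)) := by
      rw [div_le_iff₀ hm0]
      have h1 : p ^ 2 ≤ m * p * boxHeight (packedSet M (onlinePos σ M)) :=
        hMarea.trans (mul_le_mul_of_nonneg_right (not_le.1 hW).le
          (boxHeight_nonneg (isCompact_packedSet _ _)))
      nlinarith
    have hb : PiecePos (((m ^ 2 : ℕ) : ℝ) * p, p / (m : ℝ) ^ 2) := ⟨by positivity, hh⟩
    refine ⟨M ++ [(((m ^ 2 : ℕ) : ℝ) * p, p / (m : ℝ) ^ 2)], by simp [hMdef],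
      piecePos_of_mem_replicate_append hapos hb, ?_, ?_⟩
    · refine (optArea_replicate_row (m ^ 2) hn hp hh hh).trans (le_of_eq ?_)
      push_cast
      field_simp
      ring
    · have hh' := hH.trans (boxHeight_mono (isCompact_packedSet _ _)
        (packedSet_onlinePos_subset_append σ M [(((m ^ 2 : ℕ) : ℝ) * p, p / (m : ℝ) ^ 2)]) hne)
      have hw := (hlast _ hb).1
      calc (m : ℝ) * p ^ 2 = ((m ^ 2 : ℕ) : ℝ) * p * (p / m) := by
            push_cast
            field_simp
        _ ≤ _ := mul_le_mul hw hh' (by positivity) (le_trans (by positivity) hw)
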